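/- Let s, t ∈ ℝ with s ≤ N/2 and μ > 0. Then there exists C > 0 such that ‖Ṫ_u v‖_{Ḃ^{s+t-N/2}_{2,1}} ≤ C ‖u‖_{B̃_μ^{s,∞}} ‖v‖_{B̃_μ^{t,1}}. -/

import Mathlib

open MeasureTheory FourierTransform Real ENNReal

/-- Homogeneous Littlewood–Paley block `Δ̇_q f`, realized with the sharp
frequency cut-off to the dyadic annulus `2^q ≤ |ξ| < 2^{q+1}` (which gives an
equivalent norm for `L²`-based Besov spaces). -/
noncomputable def lpBlock (N : ℕ) (q : ℤ) (f : EuclideanSpace ℝ (Fin N) → ℂ) :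
    EuclideanSpace ℝ (Fin N) → ℂ :=
  𝓕⁻ (fun ξ => if (2:ℝ) ^ q ≤ ‖ξ‖ ∧ ‖ξ‖ < (2:ℝ) ^ (q + 1) then 𝓕 f ξ else 0)

/-- Low-frequency cut-off `Ṡ_{q-1} f` (frequencies `|ξ| < 2^{q-1}`). -/
noncomputable def lowFreq (N : ℕ) (q : ℤ) (f : EuclideanSpace ℝ (Fin N) → ℂ) :
    EuclideanSpace ℝ (Fin N) → ℂ :=
  𝓕⁻ (fun ξ => if ‖ξ‖ < (2:ℝ) ^ (q - 1) then 𝓕 f ξ else 0)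

/-- Homogeneous Besov norm `‖f‖_{Ḃ^s_{2,1}} = Σ_q 2^{qs} ‖Δ̇_q f‖_{L²}`. -/
noncomputable def besovNorm (N : ℕ) (s : ℝ) (f : EuclideanSpace ℝ (Fin N) → ℂ) : ℝ≥0∞ :=
  ∑' q : ℤ, ENNReal.ofReal ((2:ℝ) ^ ((q : ℝ) * s)) * eLpNorm (lpBlock N q f) 2 volume

/-- Hybrid Besov norm `‖f‖_{B̃_μ^{s,r}} = Σ_q 2^{qs} max{μ,2^{-q}}^{1-2/r} ‖Δ̇_q f‖_{L²}`. -/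
noncomputable def hybridNorm (N : ℕ) (μ s r : ℝ) (f : EuclideanSpace ℝ (Fin N) → ℂ) : ℝ≥0∞ :=
  ∑' q : ℤ, ENNReal.ofReal ((2:ℝ) ^ ((q : ℝ) * s) * max μ ((2:ℝ) ^ (-q : ℤ)) ^ (1 - 2 / r)) *
    eLpNorm (lpBlock N q f) 2 volume

/-- Hybrid Besov norm with `r = ∞`: weight `max{μ, 2^{-q}}`. -/
noncomputable def hybridNormTop (N : ℕ) (μ s : ℝ) (f : EuclideanSpace ℝ (Fin N) → ℂ) : ℝ≥0∞ :=
  ∑' q : ℤ, ENNReal.ofReal ((2:ℝ) ^ ((q : ℝ) * s) * max μ ((2:ℝ) ^ (-q : ℤ))) *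
    eLpNorm (lpBlock N q f) 2 volume

/-- Hybrid Besov norm with `r = 1`: weight `max{μ, 2^{-q}}⁻¹`. -/
noncomputable def hybridNormBot (N : ℕ) (μ s : ℝ) (f : EuclideanSpace ℝ (Fin N) → ℂ) : ℝ≥0∞ :=
  ∑' q : ℤ, ENNReal.ofReal ((2:ℝ) ^ ((q : ℝ) * s) * (max μ ((2:ℝ) ^ (-q : ℤ)))⁻¹) *
    eLpNorm (lpBlock N q f) 2 volume

/-- Bony's homogeneous paraproduct `Ṫ_u v = Σ_q Ṡ_{q-1}u Δ̇_q v`. -/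
noncomputable def paraproduct (N : ℕ) (u v : EuclideanSpace ℝ (Fin N) → ℂ) :
    EuclideanSpace ℝ (Fin N) → ℂ :=
  fun x => ∑' q : ℤ, lowFreq N q u x * lpBlock N q v x

/-- Bony's homogeneous remainder `Ṙ(u,v) = Σ_{|p-q|≤1} Δ̇_p u Δ̇_q v`. -/
noncomputable def bonyRemainder (N : ℕ) (u v : EuclideanSpace ℝ (Fin N) → ℂ) :
    EuclideanSpace ℝ (Fin N) → ℂ :=
  fun x => ∑' q : ℤ,
    (lpBlock N (q - 1) u x + lpBlock N q u x + lpBlock N (q + 1) u x) * lpBlock N q v x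

section FourierL2
open scoped SchwartzMap ContDiff
variable {V : Type*} [NormedAddCommGroup V] [InnerProductSpace ℝ V] [FiniteDimensional ℝ V]
  [MeasurableSpace V] [BorelSpace V]

theorem ae_eq_of_forall_integral_schwartz_mul_eq {f g : V → ℂ}
    (hf : LocallyIntegrable f) (hg : LocallyIntegrable g)
    (h : ∀ φ : 𝓢(V, ℂ), ∫ x, φ x * f x = ∫ x, φ x * g x) : f =ᵐ[volume] g := by
  refine ae_eq_of_integral_contDiff_smul_eq hf hg fun φ hφ hφc => ?_
  have hs : HasCompactSupport (fun x => (φ x : ℂ)) := hφc.comp_left (g := ((↑) : ℝ → ℂ)) (by simp)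
  simp_rw [Complex.real_smul]
  exact h (hs.toSchwartzMap (Complex.ofRealCLM.contDiff.comp hφ))

theorem integral_fourier_mul_eq_of_integrable {f g : V → ℂ}
    (hf : Integrable f) (hg : Integrable g) :
    ∫ ξ, 𝓕 f ξ * g ξ = ∫ x, f x * 𝓕 g x := by
  have := VectorFourier.integral_fourierIntegral_smul_eq_flip (μ := (volume : Measure V))
    (ν := (volume : Measure V)) (L := innerₗ V) (f := f) (g := g)
    Real.continuous_fourierChar continuous_inner hf hg
  rwa [flip_innerₗ] at this

theorem continuous_fourier_of_integrable {f : V → ℂ} (hf : Integrable f) :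
    Continuous (𝓕 f) :=
  VectorFourier.fourierIntegral_continuous (μ := (volume : Measure V)) (L := innerₗ V)
    Real.continuous_fourierChar continuous_inner hf

theorem eLpNorm_fourier_eq {h : V → ℂ} (h1 : Integrable h) (h2 : MemLp h 2) :
    eLpNorm (𝓕 h) 2 = eLpNorm h 2 := by
  have key : 𝓕 h =ᵐ[volume] (𝓕 (h2.toLp h) : Lp ℂ 2 (volume : Measure V)) := by
    refine ae_eq_of_forall_integral_schwartz_mul_eq
      (continuous_fourier_of_integrable h1).locallyIntegrable
      ((Lp.memLp _).locallyIntegrable one_le_two) fun φ => ?_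
    have e := congrArg (fun T => T φ) (Lp.fourier_toTemperedDistribution_eq (h2.toLp h))
    simp only [TemperedDistribution.fourier_apply, Lp.toTemperedDistribution_apply,
      smul_eq_mul] at e
    rw [← e, SchwartzMap.fourier_coe]
    calc ∫ x, φ x * 𝓕 h x = ∫ x, 𝓕 (φ : V → ℂ) x * h x :=
          (integral_fourier_mul_eq_of_integrable φ.integrable h1).symm
      _ = _ := integral_congr_ae (by
          filter_upwards [h2.coeFn_toLp] with x hx
          rw [hx])
  rw [eLpNorm_congr_ae key, ← eLpNorm_congr_ae h2.coeFn_toLp]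
  have := Lp.norm_fourier_eq (h2.toLp h)
  rw [Lp.norm_def, Lp.norm_def] at this
  exact (ENNReal.toReal_eq_toReal_iff' (Lp.eLpNorm_ne_top _) (Lp.eLpNorm_ne_top _)).1 this

theorem eLpNorm_fourierInv_eq {h : V → ℂ} (h1 : Integrable h) (h2 : MemLp h 2) :
    eLpNorm (𝓕⁻ h) 2 = eLpNorm h 2 := by
  have e : 𝓕⁻ h = 𝓕 h ∘ Neg.neg := by
    ext x
    simp [fourierInv_eq_fourier_neg]
  rw [e, eLpNorm_comp_measurePreserving (continuous_fourier_of_integrable h1).aestronglyMeasurable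
    (Measure.measurePreserving_neg _), eLpNorm_fourier_eq h1 h2]

theorem fourier_fourierInv_ae_eq {g : V → ℂ} (hg : Integrable g) (hg' : Integrable (𝓕⁻ g)) :
    𝓕 (𝓕⁻ g) =ᵐ[volume] g := by
  refine ae_eq_of_forall_integral_schwartz_mul_eq
    (continuous_fourier_of_integrable hg').locallyIntegrable hg.locallyIntegrable fun φ => ?_
  calc ∫ x, φ x * 𝓕 (𝓕⁻ g) x = ∫ x, 𝓕 (φ : V → ℂ) x * 𝓕⁻ g x :=
        (integral_fourier_mul_eq_of_integrable φ.integrable hg').symm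
    _ = ∫ x, 𝓕⁻ (φ : V → ℂ) x * 𝓕 g x := by
        rw [← integral_neg_eq_self]
        simp [fourierInv_eq_fourier_neg]
    _ = ∫ x, 𝓕 (𝓕⁻ (φ : V → ℂ)) x * g x := by
        rw [← SchwartzMap.fourierInv_coe]
        exact (integral_fourier_mul_eq_of_integrable (𝓕⁻ φ).integrable hg).symm
    _ = ∫ x, φ x * g x := by
        rw [← SchwartzMap.fourierInv_coe, ← SchwartzMap.fourier_coe, fourier_fourierInv_eq]

end FourierL2

section Convolution
open scoped Convolution
variable {V : Type*} [NormedAddCommGroup V] [InnerProductSpace ℝ V] [FiniteDimensional ℝ V]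
  [MeasurableSpace V] [BorelSpace V]

theorem fourierInv_mul_convolution_eq {f g : V → ℂ} (hf : Integrable f) (hg : Integrable g)
    (x : V) : 𝓕⁻ (f ⋆[ContinuousLinearMap.mul ℂ ℂ] g) x = 𝓕⁻ f x * 𝓕⁻ g x := by
  simp only [fourierInv_eq_fourier_neg]
  exact Real.fourier_mul_convolution_eq hf hg _

theorem enorm_convolution_mul_le (f g : V → ℂ) (x : V) :
    ‖(f ⋆[ContinuousLinearMap.mul ℂ ℂ] g) x‖ₑ ≤ ∫⁻ y, ‖f y‖ₑ * ‖g (x - y)‖ₑ := by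
  rw [convolution_def]
  refine (enorm_integral_le_lintegral_enorm _).trans_eq ?_
  simp

theorem lintegral_lintegral_mul_sub {F G : V → ℝ≥0∞} (hF : Measurable F) (hG : Measurable G) :
    ∫⁻ x, ∫⁻ y, F y * G (x - y) = (∫⁻ y, F y) * ∫⁻ x, G x := by
  rw [lintegral_lintegral_swap (by fun_prop), ← lintegral_mul_const _ hF]
  refine lintegral_congr fun y => ?_
  rw [lintegral_const_mul _ (by fun_prop), lintegral_sub_right_eq_self]

theorem lintegral_mul_sq_le {F G : V → ℝ≥0∞} (hF : Measurable F) (hG : Measurable G) :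
    (∫⁻ y, F y * G y) ^ 2 ≤ (∫⁻ y, F y) * ∫⁻ y, F y * G y ^ 2 := by
  have h := ENNReal.lintegral_mul_le_Lp_mul_Lq volume Real.HolderConjugate.two_two
    (f := fun y => F y ^ (1 / 2 : ℝ)) (g := fun y => F y ^ (1 / 2 : ℝ) * G y)
    (by fun_prop) (by fun_prop)
  have e (c : ℝ≥0∞) : c ^ (1 / 2 : ℝ) * c ^ (1 / 2 : ℝ) = c := by
    rw [← ENNReal.rpow_add_of_nonneg _ _ (by norm_num) (by norm_num)]
    norm_num
  have e' (c : ℝ≥0∞) : (c ^ (1 / 2 : ℝ)) ^ 2 = c := by rw [sq, e]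
  simp only [Pi.mul_apply, ENNReal.rpow_two, mul_pow, e', ← mul_assoc, e] at h
  calc (∫⁻ y, F y * G y) ^ 2 ≤ _ := pow_le_pow_left' h 2
    _ = _ := by rw [mul_pow, e', e']

theorem eLpNorm_two_sq {f : V → ℂ} : eLpNorm f 2 ^ 2 = ∫⁻ x, ‖f x‖ₑ ^ 2 := by
  simpa using eLpNorm_nnreal_pow_eq_lintegral (f := f) (μ := volume) (p := 2) two_ne_zero

theorem lintegral_enorm_convolution_mul_le {f g : V → ℂ} (hf : Measurable f)
    (hg : Measurable g) :
    ∫⁻ x, ‖(f ⋆[ContinuousLinearMap.mul ℂ ℂ] g) x‖ₑ ≤ (∫⁻ x, ‖f x‖ₑ) * ∫⁻ x, ‖g x‖ₑ :=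
  (lintegral_mono fun x => enorm_convolution_mul_le f g x).trans_eq
    (lintegral_lintegral_mul_sub hf.enorm hg.enorm)

theorem eLpNorm_convolution_mul_le {f g : V → ℂ} (hf : Measurable f) (hg : Measurable g) :
    eLpNorm (f ⋆[ContinuousLinearMap.mul ℂ ℂ] g) 2 ≤ (∫⁻ x, ‖f x‖ₑ) * eLpNorm g 2 := by
  rw [← ENNReal.pow_le_pow_left_iff two_ne_zero, mul_pow, eLpNorm_two_sq, eLpNorm_two_sq]
  calc ∫⁻ x, ‖(f ⋆[ContinuousLinearMap.mul ℂ ℂ] g) x‖ₑ ^ 2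
      ≤ ∫⁻ x, (∫⁻ y, ‖f y‖ₑ) * ∫⁻ y, ‖f y‖ₑ * ‖g (x - y)‖ₑ ^ 2 :=
        lintegral_mono fun x => (pow_le_pow_left' (enorm_convolution_mul_le f g x) 2).trans
          (lintegral_mul_sq_le (by fun_prop) (by fun_prop))
    _ = (∫⁻ y, ‖f y‖ₑ) * ((∫⁻ y, ‖f y‖ₑ) * ∫⁻ x, ‖g x‖ₑ ^ 2) := by
        rw [lintegral_const_mul, lintegral_lintegral_mul_sub hf.enorm (hg.enorm.pow_const 2)]
        exact Measurable.lintegral_prod_right'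
          (f := fun p : V × V => ‖f p.2‖ₑ * ‖g (p.1 - p.2)‖ₑ ^ 2) (by fun_prop)
    _ = _ := by ring

theorem lintegral_sq_le {s : Set V} {f : V → ℂ} (hs : MeasurableSet s) (hf : Measurable f) :
    ∫⁻ x in s, ‖f x‖ₑ ≤ volume s ^ (1 / 2 : ℝ) * eLpNorm (s.indicator f) 2 := by
  have h := eLpNorm_le_eLpNorm_mul_rpow_measure_univ (p := 1) (q := 2) (μ := volume.restrict s)
    one_le_two hf.aestronglyMeasurable
  rw [eLpNorm_one_eq_lintegral_enorm] at h
  rw [eLpNorm_indicator_eq_eLpNorm_restrict hs, mul_comm]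
  refine h.trans_eq ?_
  norm_num

end Convolution

section DyadicDecomposition
open scoped Convolution

/-- The frequency annulus `2^q ≤ |ξ| < 2^{q+1}` of the block `Δ̇_q`. -/
def dyadicAnnulus (V : Type*) [Norm V] (q : ℤ) : Set V :=
  {ξ | (2 : ℝ) ^ q ≤ ‖ξ‖ ∧ ‖ξ‖ < (2 : ℝ) ^ (q + 1)}

/-- The frequency ball `|ξ| < 2^{q-1}` of the cut-off `Ṡ_{q-1}`. -/
def lowFreqBall (V : Type*) [Norm V] (q : ℤ) : Set V :=
  {ξ | ‖ξ‖ < (2 : ℝ) ^ (q - 1)}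

theorem measurableSet_dyadicAnnulus {V : Type*} [NormedAddCommGroup V]
    [MeasurableSpace V] [BorelSpace V] (q : ℤ) : MeasurableSet (dyadicAnnulus V q) :=
  (measurableSet_le measurable_const measurable_norm).inter
    (measurableSet_lt measurable_norm measurable_const)

theorem measurableSet_lowFreqBall {V : Type*} [NormedAddCommGroup V]
    [MeasurableSpace V] [BorelSpace V] (q : ℤ) : MeasurableSet (lowFreqBall V q) :=
  measurableSet_lt measurable_norm measurable_const

theorem pairwise_disjoint_dyadicAnnulus {V : Type*} [NormedAddCommGroup V] :
    Pairwise (Function.onFun Disjoint (dyadicAnnulus V)) := by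
  refine fun p q hpq => Set.disjoint_left.2 fun ξ hp hq => hpq ?_
  have h1 := (zpow_lt_zpow_iff_right₀ (one_lt_two (α := ℝ))).1 (hp.1.trans_lt hq.2)
  have h2 := (zpow_lt_zpow_iff_right₀ (one_lt_two (α := ℝ))).1 (hq.1.trans_lt hp.2)
  omega

theorem exists_mem_dyadicAnnulus {V : Type*} [NormedAddCommGroup V] {ξ : V} (hξ : ξ ≠ 0) :
    ∃ q : ℤ, ξ ∈ dyadicAnnulus V q :=
  _root_.exists_mem_Ico_zpow (norm_pos_iff.2 hξ) one_lt_two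

variable {V : Type*} [NormedAddCommGroup V] [InnerProductSpace ℝ V] [FiniteDimensional ℝ V]
  [MeasurableSpace V] [BorelSpace V]

/-- The Fourier transform of `Ṡ_{q-1}u Δ̇_q v`, in terms of `F = 𝓕 u` and `G = 𝓕 v`. -/
noncomputable def paraTerm (F G : V → ℂ) (q : ℤ) : V → ℂ :=
  (lowFreqBall V q).indicator F ⋆[ContinuousLinearMap.mul ℂ ℂ] (dyadicAnnulus V q).indicator G

theorem norm_bounds_of_paraTerm_ne_zero {F G : V → ℂ} {q : ℤ} {ξ : V}
    (h : paraTerm F G q ξ ≠ 0) : (2 : ℝ) ^ (q - 1) < ‖ξ‖ ∧ ‖ξ‖ < (2 : ℝ) ^ (q + 2) := by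
  obtain ⟨x, hx, y, hy, rfl⟩ := support_convolution_subset _ h
  obtain hx' : x ∈ lowFreqBall V q := Set.mem_of_indicator_ne_zero hx
  obtain ⟨hy1, hy2⟩ : y ∈ dyadicAnnulus V q := Set.mem_of_indicator_ne_zero hy
  change ‖x‖ < (2 : ℝ) ^ (q - 1) at hx'
  change (2 : ℝ) ^ (q - 1) < ‖x + y‖ ∧ ‖x + y‖ < (2 : ℝ) ^ (q + 2)
  have h0 : (0 : ℝ) < 2 ^ (q - 1) := by positivity
  have e0 : (2 : ℝ) ^ q = 2 * 2 ^ (q - 1) := by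
    rw [← zpow_one_add₀ two_ne_zero]; congr 1; ring
  have e1 : (2 : ℝ) ^ (q + 1) = 4 * 2 ^ (q - 1) := by
    rw [zpow_add_one₀ two_ne_zero, e0]; ring
  have e2 : (2 : ℝ) ^ (q + 2) = 8 * 2 ^ (q - 1) := by
    rw [zpow_add₀ two_ne_zero, e0]; norm_num; ring
  have h1 := norm_add_le x y
  have h2 := norm_sub_le (x + y) x
  rw [add_sub_cancel_left] at h2
  constructor <;> linarith

theorem paraTerm_eq_zero_of_mem_dyadicAnnulus {F G : V → ℂ} {q j : ℤ} {ξ : V}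
    (hξ : ξ ∈ dyadicAnnulus V j) (hq : q ∉ Finset.Icc (j - 1) (j + 1)) :
    paraTerm F G q ξ = 0 := by
  by_contra h
  obtain ⟨h1, h2⟩ := norm_bounds_of_paraTerm_ne_zero h
  have h3 := (zpow_lt_zpow_iff_right₀ (one_lt_two (α := ℝ))).1 (h1.trans hξ.2)
  have h4 := (zpow_lt_zpow_iff_right₀ (one_lt_two (α := ℝ))).1 (hξ.1.trans_lt h2)
  exact hq (Finset.mem_Icc.2 (by omega))

theorem paraTerm_zero (F G : V → ℂ) (q : ℤ) : paraTerm F G q 0 = 0 := by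
  by_contra h
  have h0 : (0 : ℝ) < 2 ^ (q - 1) := by positivity
  have := (norm_bounds_of_paraTerm_ne_zero h).1
  simp only [norm_zero] at this
  linarith

theorem summable_paraTerm (F G : V → ℂ) (ξ : V) : Summable fun q => paraTerm F G q ξ := by
  rcases eq_or_ne ξ 0 with rfl | hξ
  · simp [paraTerm_zero, summable_zero]
  · obtain ⟨j, hj⟩ := exists_mem_dyadicAnnulus hξ
    exact summable_of_ne_finset_zero fun q hq => paraTerm_eq_zero_of_mem_dyadicAnnulus hj hq

variable {F G : V → ℂ}

theorem integrable_paraTerm (hF : Integrable F) (hG : Integrable G) (q : ℤ) :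
    Integrable (paraTerm F G q) :=
  (hF.indicator (measurableSet_lowFreqBall q)).integrable_convolution _
    (hG.indicator (measurableSet_dyadicAnnulus q))

theorem eLpNorm_paraTerm_le (hF : Measurable F) (hG : Measurable G) (q : ℤ) :
    eLpNorm (paraTerm F G q) 2 ≤
      (∫⁻ ξ in lowFreqBall V q, ‖F ξ‖ₑ) * eLpNorm ((dyadicAnnulus V q).indicator G) 2 := by
  refine (eLpNorm_convolution_mul_le (hF.indicator (measurableSet_lowFreqBall q))
    (hG.indicator (measurableSet_dyadicAnnulus q))).trans_eq ?_
  simp_rw [enorm_indicator_eq_indicator_enorm]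
  rw [lintegral_indicator (measurableSet_lowFreqBall q)]

theorem tsum_lintegral_paraTerm_ne_top (hF : Measurable F) (hG : Measurable G)
    (hF' : Integrable F) (hG' : Integrable G) :
    ∑' q, ∫⁻ ξ, ‖paraTerm F G q ξ‖ₑ ≠ ∞ := by
  refine ne_top_of_le_ne_top (b := (∫⁻ ξ, ‖F ξ‖ₑ) * ∫⁻ ξ, ‖G ξ‖ₑ)
    (ENNReal.mul_ne_top hF'.2.ne hG'.2.ne) ?_
  calc ∑' q, ∫⁻ ξ, ‖paraTerm F G q ξ‖ₑ
      ≤ ∑' q, (∫⁻ ξ, ‖F ξ‖ₑ) * ∫⁻ ξ in dyadicAnnulus V q, ‖G ξ‖ₑ := by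
        refine ENNReal.tsum_le_tsum fun q => ?_
        refine (lintegral_enorm_convolution_mul_le (hF.indicator (measurableSet_lowFreqBall q))
          (hG.indicator (measurableSet_dyadicAnnulus q))).trans ?_
        simp_rw [enorm_indicator_eq_indicator_enorm]
        rw [lintegral_indicator (measurableSet_lowFreqBall q),
          lintegral_indicator (measurableSet_dyadicAnnulus q)]
        gcongr
        exact Measure.restrict_le_self
    _ = (∫⁻ ξ, ‖F ξ‖ₑ) * ∫⁻ ξ in ⋃ q, dyadicAnnulus V q, ‖G ξ‖ₑ := by
        rw [ENNReal.tsum_mul_left,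
          lintegral_iUnion measurableSet_dyadicAnnulus pairwise_disjoint_dyadicAnnulus]
    _ ≤ _ := by
        gcongr
        exact Measure.restrict_le_self

theorem integrable_tsum_paraTerm (hF : Measurable F) (hG : Measurable G)
    (hF' : Integrable F) (hG' : Integrable G) :
    Integrable fun ξ => ∑' q, paraTerm F G q ξ := by
  refine ⟨aestronglyMeasurable_of_tendsto_ae Filter.atTop
    (fun s : Finset ℤ => (integrable_finsetSum s fun q _ =>
      integrable_paraTerm hF' hG' q).aestronglyMeasurable)
    (Filter.Eventually.of_forall fun ξ => (summable_paraTerm F G ξ).hasSum), ?_⟩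
  refine lt_of_le_of_lt ?_ (tsum_lintegral_paraTerm_ne_top hF hG hF' hG').lt_top
  rw [← lintegral_tsum fun q => (integrable_paraTerm hF' hG' q).aestronglyMeasurable.enorm]
  exact lintegral_mono fun ξ => enorm_tsum_le_tsum_enorm

theorem fourierInv_tsum_paraTerm (hF : Measurable F) (hG : Measurable G)
    (hF' : Integrable F) (hG' : Integrable G) (x : V) :
    𝓕⁻ (fun ξ => ∑' q, paraTerm F G q ξ) x =
      ∑' q, 𝓕⁻ ((lowFreqBall V q).indicator F) x * 𝓕⁻ ((dyadicAnnulus V q).indicator G) x := by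
  have h (q : ℤ) := fourierInv_mul_convolution_eq
    (hF'.indicator (measurableSet_lowFreqBall q)) (hG'.indicator (measurableSet_dyadicAnnulus q)) x
  simp_rw [← h]
  change _ = ∑' q, 𝓕⁻ (paraTerm F G q) x
  simp_rw [fourierInv_eq, Circle.smul_def, ← tsum_const_smul'']
  refine integral_tsum (fun q => ?_) ?_
  · exact ((Real.continuous_fourierChar.comp (by fun_prop)).aestronglyMeasurable).smul
      (integrable_paraTerm hF' hG' q).aestronglyMeasurable
  · have h1 (z : Circle) : ‖(z : ℂ)‖ₑ = 1 := by
      rw [← ofReal_norm, Circle.norm_coe, ofReal_one]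
    simpa [enorm_smul, h1] using tsum_lintegral_paraTerm_ne_top hF hG hF' hG'

theorem indicator_tsum_paraTerm (j : ℤ) :
    (dyadicAnnulus V j).indicator (fun ξ => ∑' q, paraTerm F G q ξ) =
      (dyadicAnnulus V j).indicator (∑ q ∈ Finset.Icc (j - 1) (j + 1), paraTerm F G q) := by
  refine Set.indicator_congr fun ξ hξ => ?_
  rw [Finset.sum_apply]
  exact tsum_eq_sum fun q hq => paraTerm_eq_zero_of_mem_dyadicAnnulus hξ hq

theorem eLpNorm_block_paraproduct_le (hF : Measurable F) (hG : Measurable G)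
    (hF' : Integrable F) (hG' : Integrable G) (hG2 : MemLp G 2) (j : ℤ) :
    eLpNorm (𝓕⁻ ((dyadicAnnulus V j).indicator (𝓕 (fun x => ∑' q,
      𝓕⁻ ((lowFreqBall V q).indicator F) x * 𝓕⁻ ((dyadicAnnulus V q).indicator G) x)))) 2 ≤
    ∑ q ∈ Finset.Icc (j - 1) (j + 1),
      (∫⁻ ξ in lowFreqBall V q, ‖F ξ‖ₑ) * eLpNorm ((dyadicAnnulus V q).indicator G) 2 := by
  have e : (fun x => ∑' q, 𝓕⁻ ((lowFreqBall V q).indicator F) x *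
      𝓕⁻ ((dyadicAnnulus V q).indicator G) x) = 𝓕⁻ (fun ξ => ∑' q, paraTerm F G q ξ) :=
    funext fun x => (fourierInv_tsum_paraTerm hF hG hF' hG' x).symm
  rw [e]
  by_cases hP : Integrable (𝓕⁻ (fun ξ => ∑' q, paraTerm F G q ξ))
  · have hae : (dyadicAnnulus V j).indicator (𝓕 (𝓕⁻ (fun ξ => ∑' q, paraTerm F G q ξ)))
        =ᵐ[volume]
        (dyadicAnnulus V j).indicator (∑ q ∈ Finset.Icc (j - 1) (j + 1), paraTerm F G q) := by
      rw [← indicator_tsum_paraTerm]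
      exact (fourier_fourierInv_ae_eq (integrable_tsum_paraTerm hF hG hF' hG') hP).indicator
    have h1 : Integrable (∑ q ∈ Finset.Icc (j - 1) (j + 1), paraTerm F G q) :=
      integrable_finsetSum' _ fun q _ => integrable_paraTerm hF' hG' q
    have hle : eLpNorm (∑ q ∈ Finset.Icc (j - 1) (j + 1), paraTerm F G q) 2 ≤
        ∑ q ∈ Finset.Icc (j - 1) (j + 1),
          (∫⁻ ξ in lowFreqBall V q, ‖F ξ‖ₑ) * eLpNorm ((dyadicAnnulus V q).indicator G) 2 :=
      (eLpNorm_sum_le (fun q _ => (integrable_paraTerm hF' hG' q).aestronglyMeasurable)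
        one_le_two).trans (Finset.sum_le_sum fun q _ => eLpNorm_paraTerm_le hF hG q)
    have h2 : MemLp (∑ q ∈ Finset.Icc (j - 1) (j + 1), paraTerm F G q) 2 := by
      refine ⟨h1.aestronglyMeasurable, hle.trans_lt (ENNReal.sum_lt_top.2 fun q _ => ?_)⟩
      exact ENNReal.mul_lt_top (hF'.restrict.2)
        (hG2.indicator (measurableSet_dyadicAnnulus q)).2
    rw [funext (fun x => fourierInv_congr_ae hae x),
      eLpNorm_fourierInv_eq (h1.indicator (measurableSet_dyadicAnnulus j))
        (h2.indicator (measurableSet_dyadicAnnulus j))]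
    exact (eLpNorm_indicator_le _).trans hle
  · have h0 : 𝓕 (𝓕⁻ (fun ξ => ∑' q, paraTerm F G q ξ)) = 0 := by
      ext ξ
      rw [fourier_eq]
      exact integral_undef (by rwa [Real.fourierIntegral_convergent_iff])
    rw [h0, Set.indicator_zero']
    have : 𝓕⁻ (0 : V → ℂ) = 0 := by
      ext x
      simp [fourierInv_eq]
    simp [this]

end DyadicDecomposition

section Weights
variable {N : ℕ}

theorem lpBlock_eq (q : ℤ) (f : EuclideanSpace ℝ (Fin N) → ℂ) :
    lpBlock N q f = 𝓕⁻ ((dyadicAnnulus _ q).indicator (𝓕 f)) := by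
  classical
  unfold lpBlock
  congr 1
  ext ξ
  simp [Set.indicator_apply, dyadicAnnulus]

theorem lowFreq_eq (q : ℤ) (f : EuclideanSpace ℝ (Fin N) → ℂ) :
    lowFreq N q f = 𝓕⁻ ((lowFreqBall _ q).indicator (𝓕 f)) := by
  classical
  unfold lowFreq
  congr 1

theorem eLpNorm_lpBlock_eq (q : ℤ) (u : SchwartzMap (EuclideanSpace ℝ (Fin N)) ℂ) :
    eLpNorm (lpBlock N q u) 2 =
      eLpNorm ((dyadicAnnulus _ q).indicator (𝓕 (u : EuclideanSpace ℝ (Fin N) → ℂ))) 2 := by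
  rw [lpBlock_eq, ← SchwartzMap.fourier_coe]
  exact eLpNorm_fourierInv_eq ((𝓕 u).integrable.indicator (measurableSet_dyadicAnnulus q))
    (((𝓕 u).memLp 2).indicator (measurableSet_dyadicAnnulus q))

theorem eLpNorm_lpBlock_paraproduct_le
    (u v : SchwartzMap (EuclideanSpace ℝ (Fin N)) ℂ) (j : ℤ) :
    eLpNorm (lpBlock N j (paraproduct N u v)) 2 ≤ ∑ q ∈ Finset.Icc (j - 1) (j + 1),
      (∫⁻ ξ in lowFreqBall _ q, ‖𝓕 (u : EuclideanSpace ℝ (Fin N) → ℂ) ξ‖ₑ) *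
        eLpNorm (lpBlock N q v) 2 := by
  simp_rw [eLpNorm_lpBlock_eq]
  rw [lpBlock_eq]
  unfold paraproduct
  simp_rw [lowFreq_eq, lpBlock_eq, ← SchwartzMap.fourier_coe]
  exact eLpNorm_block_paraproduct_le (𝓕 u).continuous.measurable (𝓕 v).continuous.measurable
    (𝓕 u).integrable (𝓕 v).integrable ((𝓕 v).memLp 2) j

theorem volume_dyadicAnnulus_rpow_le [Nontrivial (EuclideanSpace ℝ (Fin N))] (p : ℤ) :
    volume (dyadicAnnulus (EuclideanSpace ℝ (Fin N)) p) ^ (1 / 2 : ℝ) ≤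
      ENNReal.ofReal ((2 : ℝ) ^ (((p : ℝ) + 1) * (N / 2))) *
        volume (Metric.ball (0 : EuclideanSpace ℝ (Fin N)) 1) ^ (1 / 2 : ℝ) := by
  have hsub : dyadicAnnulus (EuclideanSpace ℝ (Fin N)) p ⊆ Metric.ball 0 ((2 : ℝ) ^ (p + 1)) :=
    fun ξ hξ => mem_ball_zero_iff.2 hξ.2
  calc _ ≤ (volume (Metric.ball (0 : EuclideanSpace ℝ (Fin N)) ((2 : ℝ) ^ (p + 1)))) ^
        (1 / 2 : ℝ) := by gcongr
    _ = _ := by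
      rw [Measure.addHaar_ball _ _ (by positivity), finrank_euclideanSpace_fin,
        ENNReal.mul_rpow_of_nonneg _ _ (by norm_num),
        ENNReal.ofReal_rpow_of_nonneg (by positivity) (by norm_num)]
      congr 2
      rw [← Real.rpow_natCast, ← Real.rpow_intCast, ← Real.rpow_mul two_pos.le,
        ← Real.rpow_mul two_pos.le]
      congr 1
      push_cast
      ring

theorem lowFreqBall_subset {V : Type*} [NormedAddCommGroup V] (q : ℤ) :
    lowFreqBall V q ⊆ {0} ∪ ⋃ p : {p : ℤ // p ≤ q - 2}, dyadicAnnulus V p := by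
  intro ξ hξ
  rcases eq_or_ne ξ 0 with h | h
  · exact Or.inl h
  · obtain ⟨p, hp⟩ := exists_mem_dyadicAnnulus h
    have := (zpow_lt_zpow_iff_right₀ (one_lt_two (α := ℝ))).1
      (hp.1.trans_lt (show ‖ξ‖ < (2 : ℝ) ^ (q - 1) from hξ))
    exact Or.inr (Set.mem_iUnion.2 ⟨⟨p, by omega⟩, hp⟩)

theorem two_rpow_le_weight {s μ : ℝ} (hs : s ≤ N / 2) (hμ : 0 < μ) {p q : ℤ} (hpq : p ≤ q) :
    (2 : ℝ) ^ ((p : ℝ) * (N / 2)) ≤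
      ((2 : ℝ) ^ ((q : ℝ) * (N / 2 - s)) * (max μ ((2 : ℝ) ^ (-q : ℤ)))⁻¹) *
        ((2 : ℝ) ^ ((p : ℝ) * s) * max μ ((2 : ℝ) ^ (-p : ℤ))) := by
  have h1 : (2 : ℝ) ^ ((p : ℝ) * (N / 2 - s)) ≤ (2 : ℝ) ^ ((q : ℝ) * (N / 2 - s)) := by
    apply Real.rpow_le_rpow_of_exponent_le one_le_two
    have : (p : ℝ) ≤ q := by exact_mod_cast hpq
    nlinarith
  have hq : 0 < max μ ((2 : ℝ) ^ (-q : ℤ)) := lt_max_of_lt_left hμ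
  have h2 : 1 ≤ (max μ ((2 : ℝ) ^ (-q : ℤ)))⁻¹ * max μ ((2 : ℝ) ^ (-p : ℤ)) := by
    rw [inv_mul_eq_div, one_le_div hq]
    exact max_le_max le_rfl (zpow_le_zpow_right₀ one_le_two (by omega))
  calc (2 : ℝ) ^ ((p : ℝ) * (N / 2))
      = (2 : ℝ) ^ ((p : ℝ) * (N / 2 - s)) * (2 : ℝ) ^ ((p : ℝ) * s) * 1 := by
        rw [mul_one, ← Real.rpow_add two_pos]
        congr 1
        ring
    _ ≤ (2 : ℝ) ^ ((q : ℝ) * (N / 2 - s)) * (2 : ℝ) ^ ((p : ℝ) * s) *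
        ((max μ ((2 : ℝ) ^ (-q : ℤ)))⁻¹ * max μ ((2 : ℝ) ^ (-p : ℤ))) := by gcongr
    _ = _ := by ring

theorem lintegral_lowFreqBall_le [Nontrivial (EuclideanSpace ℝ (Fin N))] {s μ : ℝ}
    (hs : s ≤ N / 2) (hμ : 0 < μ) (u : SchwartzMap (EuclideanSpace ℝ (Fin N)) ℂ) (q : ℤ) :
    ∫⁻ ξ in lowFreqBall _ q, ‖𝓕 (u : EuclideanSpace ℝ (Fin N) → ℂ) ξ‖ₑ ≤
      ENNReal.ofReal ((2 : ℝ) ^ ((N : ℝ) / 2)) *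
        volume (Metric.ball (0 : EuclideanSpace ℝ (Fin N)) 1) ^ (1 / 2 : ℝ) *
      ENNReal.ofReal ((2 : ℝ) ^ ((q : ℝ) * (N / 2 - s)) * (max μ ((2 : ℝ) ^ (-q : ℤ)))⁻¹) *
        hybridNormTop N μ s u := by
  set κ := volume (Metric.ball (0 : EuclideanSpace ℝ (Fin N)) 1) ^ (1 / 2 : ℝ)
  set w := (2 : ℝ) ^ ((q : ℝ) * (N / 2 - s)) * (max μ ((2 : ℝ) ^ (-q : ℤ)))⁻¹
  have hw : 0 ≤ w := mul_nonneg (by positivity) (inv_nonneg.2 (le_max_of_le_left hμ.le))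
  have hF : Measurable (𝓕 (u : EuclideanSpace ℝ (Fin N) → ℂ)) := by
    rw [← SchwartzMap.fourier_coe]
    exact (𝓕 u).continuous.measurable
  calc ∫⁻ ξ in lowFreqBall _ q, ‖𝓕 (u : EuclideanSpace ℝ (Fin N) → ℂ) ξ‖ₑ
      ≤ ∫⁻ ξ in {0} ∪ ⋃ p : {p : ℤ // p ≤ q - 2}, dyadicAnnulus _ p,
          ‖𝓕 (u : EuclideanSpace ℝ (Fin N) → ℂ) ξ‖ₑ := lintegral_mono_set (lowFreqBall_subset q)
    _ ≤ 0 + ∑' p : {p : ℤ // p ≤ q - 2}, ∫⁻ ξ in dyadicAnnulus _ p,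
          ‖𝓕 (u : EuclideanSpace ℝ (Fin N) → ℂ) ξ‖ₑ := by
        refine (lintegral_union_le _ _ _).trans (add_le_add ?_ (lintegral_iUnion_le _ _))
        simp
    _ ≤ ∑' p : {p : ℤ // p ≤ q - 2}, ENNReal.ofReal ((2 : ℝ) ^ ((N : ℝ) / 2)) * κ *
          ENNReal.ofReal w * (ENNReal.ofReal ((2 : ℝ) ^ ((p : ℝ) * s) *
            max μ ((2 : ℝ) ^ (-p : ℤ))) * eLpNorm (lpBlock N p u) 2 volume) := by
        rw [zero_add]
        refine ENNReal.tsum_le_tsum fun p => ?_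
        refine (lintegral_sq_le (measurableSet_dyadicAnnulus _) hF).trans ?_
        rw [eLpNorm_lpBlock_eq, ← mul_assoc]
        gcongr
        refine (volume_dyadicAnnulus_rpow_le _).trans ?_
        rw [add_mul, one_mul, Real.rpow_add two_pos, mul_comm ((2 : ℝ) ^ _),
          ENNReal.ofReal_mul (by positivity), mul_right_comm, mul_assoc _ (ENNReal.ofReal w),
          ← ENNReal.ofReal_mul hw]
        gcongr
        exact two_rpow_le_weight hs hμ (by have := p.2; omega)
    _ ≤ _ := by
        rw [ENNReal.tsum_mul_left, hybridNormTop]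
        refine mul_le_mul' le_rfl ?_
        exact ENNReal.tsum_comp_le_tsum_of_injective Subtype.val_injective _

theorem tsum_weight_mul_sum_Icc_le (σ : ℝ) (T : ℤ → ℝ≥0∞) :
    ∑' j : ℤ, ENNReal.ofReal ((2 : ℝ) ^ ((j : ℝ) * σ)) * ∑ q ∈ Finset.Icc (j - 1) (j + 1), T q ≤
      ENNReal.ofReal (3 * 2 ^ |σ|) * ∑' q : ℤ, ENNReal.ofReal ((2 : ℝ) ^ ((q : ℝ) * σ)) * T q := by
  have hIcc (j : ℤ) : ∑ q ∈ Finset.Icc (j - 1) (j + 1), T q =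
      ∑ k ∈ Finset.Icc (-1 : ℤ) 1, T (j + k) := by
    rw [sub_eq_add_neg, ← Finset.map_add_left_Icc, Finset.sum_map]
    rfl
  have hshift (k : ℤ) (hk : k ∈ Finset.Icc (-1 : ℤ) 1) :
      ∑' j : ℤ, ENNReal.ofReal ((2 : ℝ) ^ ((j : ℝ) * σ)) * T (j + k) ≤
        ENNReal.ofReal (2 ^ |σ|) * ∑' q : ℤ, ENNReal.ofReal ((2 : ℝ) ^ ((q : ℝ) * σ)) * T q := by
    rw [← (Equiv.addRight k).tsum_eq
      (fun q : ℤ => ENNReal.ofReal ((2 : ℝ) ^ ((q : ℝ) * σ)) * T q), ← ENNReal.tsum_mul_left]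
    refine ENNReal.tsum_le_tsum fun j => ?_
    rw [← mul_assoc, ← ENNReal.ofReal_mul (by positivity), ← Real.rpow_add two_pos]
    simp only [Equiv.coe_addRight]
    gcongr
    · exact one_le_two
    · have h1 : |(k : ℝ)| ≤ 1 := by
        rw [Finset.mem_Icc] at hk
        exact abs_le.2 ⟨by exact_mod_cast hk.1, by exact_mod_cast hk.2⟩
      have h2 : -((k : ℝ) * σ) ≤ |σ| := (neg_le_abs _).trans (by
        rw [abs_mul]
        exact mul_le_of_le_one_left (abs_nonneg σ) h1)
      push_cast
      linarith
  calc _ = ∑ k ∈ Finset.Icc (-1 : ℤ) 1,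
        ∑' j : ℤ, ENNReal.ofReal ((2 : ℝ) ^ ((j : ℝ) * σ)) * T (j + k) := by
        simp_rw [hIcc, Finset.mul_sum]
        exact Summable.tsum_finsetSum fun _ _ => ENNReal.summable
    _ ≤ _ := Finset.sum_le_sum hshift
    _ = _ := by
        rw [Finset.sum_const, ENNReal.ofReal_mul (by norm_num), nsmul_eq_mul, mul_assoc]
        simp

theorem besovNorm_of_subsingleton [Subsingleton (EuclideanSpace ℝ (Fin N))] (s : ℝ)
    (f : EuclideanSpace ℝ (Fin N) → ℂ) : besovNorm N s f = 0 := by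
  have h (q : ℤ) : dyadicAnnulus (EuclideanSpace ℝ (Fin N)) q = ∅ := by
    refine Set.eq_empty_of_forall_notMem fun ξ hξ => ?_
    have h0 : (0 : ℝ) < 2 ^ q := by positivity
    have := hξ.1
    rw [Subsingleton.elim ξ 0, norm_zero] at this
    linarith
  have h0 (q : ℤ) : lpBlock N q f = 0 := by
    ext x
    simp [lpBlock_eq, h, fourierInv_eq]
  simp [besovNorm, h0]

end Weights

/-- Paraproduct estimate in hybrid Besov spaces: for `s ≤ N/2` and `μ > 0`,
`‖Ṫ_u v‖_{Ḃ^{s+t-N/2}_{2,1}} ≤ C ‖u‖_{B̃_μ^{s,∞}} ‖v‖_{B̃_μ^{t,1}}`. -/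
theorem paraproduct_estimate_top_bot (N : ℕ) (s t μ : ℝ) (hs : s ≤ N / 2) (hμ : 0 < μ) :
    ∃ C : ℝ, 0 < C ∧
      ∀ u v : SchwartzMap (EuclideanSpace ℝ (Fin N)) ℂ,
        besovNorm N (s + t - N / 2) (paraproduct N ⇑u ⇑v) ≤
          ENNReal.ofReal C * hybridNormTop N μ s ⇑u * hybridNormBot N μ t ⇑v := by
  rcases subsingleton_or_nontrivial (EuclideanSpace ℝ (Fin N)) with hN | hN
  · exact ⟨1, one_pos, fun u v => by simp [besovNorm_of_subsingleton]⟩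
  set σ := s + t - N / 2 with hσ
  set K := ENNReal.ofReal ((2 : ℝ) ^ ((N : ℝ) / 2)) *
    volume (Metric.ball (0 : EuclideanSpace ℝ (Fin N)) 1) ^ (1 / 2 : ℝ)
  have hball : volume (Metric.ball (0 : EuclideanSpace ℝ (Fin N)) 1) ^ (1 / 2 : ℝ) ≠ ∞ :=
    ENNReal.rpow_ne_top_of_nonneg (by norm_num) measure_ball_lt_top.ne
  have hK_top : K ≠ ∞ := ENNReal.mul_ne_top ENNReal.ofReal_ne_top hball
  have hK_pos : 0 < K.toReal := by
    refine ENNReal.toReal_pos (mul_ne_zero ?_ ?_) hK_top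
    · exact (ENNReal.ofReal_pos.2 (by positivity)).ne'
    · exact (ENNReal.rpow_pos (Metric.measure_ball_pos _ _ one_pos) measure_ball_lt_top.ne).ne'

  refine ⟨3 * 2 ^ |σ| * K.toReal, by positivity, fun u v => ?_⟩
  calc besovNorm N σ (paraproduct N u v)
      ≤ ∑' j : ℤ, ENNReal.ofReal ((2 : ℝ) ^ ((j : ℝ) * σ)) * ∑ q ∈ Finset.Icc (j - 1) (j + 1),
          (∫⁻ ξ in lowFreqBall _ q, ‖𝓕 (u : EuclideanSpace ℝ (Fin N) → ℂ) ξ‖ₑ) *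
            eLpNorm (lpBlock N q v) 2 volume :=
        ENNReal.tsum_le_tsum fun j => mul_le_mul' le_rfl (eLpNorm_lpBlock_paraproduct_le u v j)
    _ ≤ ENNReal.ofReal (3 * 2 ^ |σ|) * ∑' q : ℤ, ENNReal.ofReal ((2 : ℝ) ^ ((q : ℝ) * σ)) *
          ((∫⁻ ξ in lowFreqBall _ q, ‖𝓕 (u : EuclideanSpace ℝ (Fin N) → ℂ) ξ‖ₑ) *
            eLpNorm (lpBlock N q v) 2 volume) := tsum_weight_mul_sum_Icc_le _ _
    _ ≤ ENNReal.ofReal (3 * 2 ^ |σ|) * ∑' q : ℤ, K * hybridNormTop N μ s u *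
          (ENNReal.ofReal ((2 : ℝ) ^ ((q : ℝ) * t) * (max μ ((2 : ℝ) ^ (-q : ℤ)))⁻¹) *
            eLpNorm (lpBlock N q v) 2 volume) := by
        refine mul_le_mul' le_rfl (ENNReal.tsum_le_tsum fun q => ?_)
        have hw : (2 : ℝ) ^ ((q : ℝ) * t) * (max μ ((2 : ℝ) ^ (-q : ℤ)))⁻¹ =
            (2 : ℝ) ^ ((q : ℝ) * σ) *
              ((2 : ℝ) ^ ((q : ℝ) * (N / 2 - s)) * (max μ ((2 : ℝ) ^ (-q : ℤ)))⁻¹) := by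
          rw [← mul_assoc, ← Real.rpow_add two_pos]
          congr 2
          rw [hσ]
          ring
        rw [hw, ENNReal.ofReal_mul (by positivity)]
        calc _ ≤ _ * ((_ : ℝ≥0∞) * _) :=
              mul_le_mul_right (mul_le_mul_left (lintegral_lowFreqBall_le hs hμ u q) _) _
          _ = _ := by ring
    _ = _ := by
        rw [ENNReal.tsum_mul_left, ENNReal.ofReal_mul (q := K.toReal) (by positivity),
          ENNReal.ofReal_toReal hK_top, hybridNormBot]
        ring
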